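/- Let R be an associative ring with unit, T a tilting module in Mod R, and (A, B) the induced tilting cotorsion pair, i.e. B = T^⊥ and A = ^{⊥1}B. Then pd T = pd_A(A) = coresdim_B(A) = coresdim_{Add T}(A) = coresdim_B(Mod R). -/

import Mathlib

noncomputable section

open CategoryTheory CategoryTheory.Limits Opposite DirectSum

universe u

namespace CotorsionDim

variable {R : Type u} [Ring R]

/-- `Ext^n_R(M,N) = 0`. -/
def ExtZero (M N : ModuleCat.{u} R) (n : ℕ) : Prop :=
  IsZero (((Ext ℤ (ModuleCat.{u} R) n).obj (op M)).obj N)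

/-- A pair of composable maps forms a short exact sequence `0 → A → B → C → 0`. -/
def IsSES {A B C : ModuleCat.{u} R} (f : A ⟶ B) (g : B ⟶ C) : Prop :=
  ∃ w : f ≫ g = 0, (CategoryTheory.ShortComplex.mk f g w).ShortExact

/-- relative projective dimension `pd_𝒳(M)` -/
def rpd (𝒳 : Set (ModuleCat.{u} R)) (M : ModuleCat.{u} R) : ℕ∞ :=
  sInf {n : ℕ∞ | ∀ j : ℕ, n < (j : ℕ∞) → ∀ X ∈ 𝒳, ExtZero M X j}

/-- relative injective dimension `id_𝒳(M)` -/
def rid (𝒳 : Set (ModuleCat.{u} R)) (M : ModuleCat.{u} R) : ℕ∞ :=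
  sInf {n : ℕ∞ | ∀ j : ℕ, n < (j : ℕ∞) → ∀ X ∈ 𝒳, ExtZero X M j}

/-- `pd_𝒳(𝒴)` -/
def rpdClass (𝒳 𝒴 : Set (ModuleCat.{u} R)) : ℕ∞ := ⨆ Y : 𝒴, rpd 𝒳 Y

/-- `id_𝒳(𝒴)` -/
def ridClass (𝒳 𝒴 : Set (ModuleCat.{u} R)) : ℕ∞ := ⨆ Y : 𝒴, rid 𝒳 Y

/-- projective dimension -/
def pd (M : ModuleCat.{u} R) : ℕ∞ := rpd Set.univ M

/-- injective dimension -/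
def idim (M : ModuleCat.{u} R) : ℕ∞ := rid Set.univ M

/-- `pd(𝒴)` -/
def pdClass (𝒴 : Set (ModuleCat.{u} R)) : ℕ∞ := ⨆ Y : 𝒴, pd Y.1

/-- `id(𝒴)` -/
def idClass (𝒴 : Set (ModuleCat.{u} R)) : ℕ∞ := ⨆ Y : 𝒴, idim Y.1

/-- `M` has an `𝒳`-resolution `0 → X_n → ⋯ → X_0 → M → 0` of length `n`. -/
def HasResLen (𝒳 : Set (ModuleCat.{u} R)) : ℕ → ModuleCat.{u} R → Prop
  | 0, M => M ∈ 𝒳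
  | n+1, M => ∃ (K X : ModuleCat.{u} R) (f : K ⟶ X) (g : X ⟶ M),
      X ∈ 𝒳 ∧ IsSES f g ∧ HasResLen 𝒳 n K

/-- `M` has an `𝒳`-coresolution `0 → M → X_0 → ⋯ → X_n → 0` of length `n`. -/
def HasCoresLen (𝒳 : Set (ModuleCat.{u} R)) : ℕ → ModuleCat.{u} R → Prop
  | 0, M => M ∈ 𝒳
  | n+1, M => ∃ (X C : ModuleCat.{u} R) (f : M ⟶ X) (g : X ⟶ C),
      X ∈ 𝒳 ∧ IsSES f g ∧ HasCoresLen 𝒳 n C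

/-- `resdim_𝒳(M)` -/
def resdim (𝒳 : Set (ModuleCat.{u} R)) (M : ModuleCat.{u} R) : ℕ∞ :=
  ⨅ n : {n : ℕ // HasResLen 𝒳 n M}, (n : ℕ∞)

/-- `coresdim_𝒳(M)` -/
def coresdim (𝒳 : Set (ModuleCat.{u} R)) (M : ModuleCat.{u} R) : ℕ∞ :=
  ⨅ n : {n : ℕ // HasCoresLen 𝒳 n M}, (n : ℕ∞)

/-- `resdim_𝒳(𝒴)` -/
def resdimClass (𝒳 𝒴 : Set (ModuleCat.{u} R)) : ℕ∞ := ⨆ Y : 𝒴, resdim 𝒳 Y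

/-- `coresdim_𝒳(𝒴)` -/
def coresdimClass (𝒳 𝒴 : Set (ModuleCat.{u} R)) : ℕ∞ := ⨆ Y : 𝒴, coresdim 𝒳 Y

/-- `𝒳^∧`, the class of modules with a finite `𝒳`-resolution. -/
def resClosure (𝒳 : Set (ModuleCat.{u} R)) : Set (ModuleCat.{u} R) :=
  {M | ∃ n, HasResLen 𝒳 n M}

/-- `𝒳^∨`, the class of modules with a finite `𝒳`-coresolution. -/
def coresClosure (𝒳 : Set (ModuleCat.{u} R)) : Set (ModuleCat.{u} R) :=
  {M | ∃ n, HasCoresLen 𝒳 n M}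

/-- `(𝒜, ℬ)` is a cotorsion pair. -/
def IsCotorsionPair (𝒜 ℬ : Set (ModuleCat.{u} R)) : Prop :=
  (∀ M, M ∈ 𝒜 ↔ ∀ B ∈ ℬ, ExtZero M B 1) ∧
  (∀ M, M ∈ ℬ ↔ ∀ A ∈ 𝒜, ExtZero A M 1)

/-- completeness of a cotorsion pair -/
def IsComplete (𝒜 ℬ : Set (ModuleCat.{u} R)) : Prop :=
  ∀ M : ModuleCat.{u} R,
    (∃ (B A : ModuleCat.{u} R) (f : B ⟶ A) (g : A ⟶ M), B ∈ ℬ ∧ A ∈ 𝒜 ∧ IsSES f g) ∧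
    (∃ (B A : ModuleCat.{u} R) (f : M ⟶ B) (g : B ⟶ A), B ∈ ℬ ∧ A ∈ 𝒜 ∧ IsSES f g)

/-- heredity of a cotorsion pair -/
def IsHereditary (𝒜 ℬ : Set (ModuleCat.{u} R)) : Prop :=
  ∀ i : ℕ, 1 ≤ i → ∀ A ∈ 𝒜, ∀ B ∈ ℬ, ExtZero A B i

variable (R)

/-- `𝒫`, the class of modules of finite projective dimension. -/
def P : Set (ModuleCat.{u} R) := {M | pd M < ⊤}

variable {R}

/-- `M` admits a projective resolution consisting of finitely generated projectives,
i.e. `M ∈ mod R`. -/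
def InmodR (M : ModuleCat.{u} R) : Prop :=
  ∃ K : ℕ → ModuleCat.{u} R, K 0 = M ∧ ∀ i : ℕ,
    ∃ (Q : ModuleCat.{u} R) (f : K (i+1) ⟶ Q) (g : Q ⟶ K i),
      Module.Finite R Q ∧ Projective Q ∧ IsSES f g

variable (R)

/-- `𝒫^{<∞} = 𝒫 ∩ mod R`. -/
def Pfin : Set (ModuleCat.{u} R) := {M | pd M < ⊤ ∧ InmodR M}

/-- the big finitistic dimension -/
def bigFindim : ℕ∞ := pdClass (P R)

/-- the little finitistic dimension -/
def littleFindim : ℕ∞ := pdClass (Pfin R)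

variable {R}

/-- `𝒳^{⊥₁}` -/
def rperp1 (𝒳 : Set (ModuleCat.{u} R)) : Set (ModuleCat.{u} R) :=
  {M | ∀ X ∈ 𝒳, ExtZero X M 1}

/-- `^{⊥₁}𝒳` -/
def lperp1 (𝒳 : Set (ModuleCat.{u} R)) : Set (ModuleCat.{u} R) :=
  {M | ∀ X ∈ 𝒳, ExtZero M X 1}

/-- `T^⊥ = {M : Ext^i(T,M) = 0 for all i > 0}` -/
def rperpAll (T : ModuleCat.{u} R) : Set (ModuleCat.{u} R) :=
  {M | ∀ i : ℕ, 0 < i → ExtZero T M i}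

/-- `Add T`: direct summands of arbitrary direct sums of copies of `T`. -/
def AddT (T : ModuleCat.{u} R) : Set (ModuleCat.{u} R) :=
  {M | ∃ (I : Type u) (s : M ⟶ ModuleCat.of R (I →₀ T)) (r : ModuleCat.of R (I →₀ T) ⟶ M),
    s ≫ r = 𝟙 M}

/-- `T` is a tilting module. -/
def IsTilting (T : ModuleCat.{u} R) : Prop :=
  pd T < ⊤ ∧
  (∀ i : ℕ, 0 < i → ∀ I : Type u, ExtZero T (ModuleCat.of R (I →₀ T)) i) ∧
  ∃ n, HasCoresLen (AddT T) n (ModuleCat.of R R)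


/-- `𝒳` is closed under arbitrary direct sums (coproducts). -/
def ClosedUnderCoproducts (𝒳 : Set (ModuleCat.{u} R)) : Prop :=
  ∀ (I : Type u) (f : I → ModuleCat.{u} R), (∀ i, f i ∈ 𝒳) →
    ModuleCat.of R (⨁ i, (f i : Type u)) ∈ 𝒳

/-- `𝒳` is closed under direct summands. -/
def ClosedUnderSummands (𝒳 : Set (ModuleCat.{u} R)) : Prop :=
  ∀ (M N : ModuleCat.{u} R) (s : M ⟶ N) (r : N ⟶ M), s ≫ r = 𝟙 M → N ∈ 𝒳 → M ∈ 𝒳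

section ExtVanishing

variable {R : Type u} [Ring R] {A B C M N X Y : ModuleCat.{u} R}

/-- The vanishing of the derived functor `Ext` agrees with that of Yoneda `Ext`. -/
theorem extZero_succ_iff (M N : ModuleCat.{u} R) (n : ℕ) :
    ExtZero M N (n + 1) ↔ ∀ x : Abelian.Ext M N (n + 1), x = 0 := by
  let P := ProjectiveResolution.of M
  unfold ExtZero
  rw [(P.isoExt (R := ℤ) (n + 1) N).isZero_iff, ← HomologicalComplex.exactAt_iff_isZero_homology,
    HomologicalComplex.exactAt_iff' _ n (n + 1) (n + 1 + 1) (by simp) (by simp),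
    ShortComplex.moduleCat_exact_iff]
  constructor
  · intro h x
    obtain ⟨f, hf, rfl⟩ := P.extMk_surjective x (n + 1 + 1) rfl
    rw [P.extMk_eq_zero_iff f _ rfl hf n rfl]
    exact h f hf
  · intro h f hf
    exact (P.extMk_eq_zero_iff f (n + 1 + 1) rfl hf n rfl).1 (h _)

theorem IsSES.mk' {f : A ⟶ B} {g : B ⟶ C} (hf : Function.Injective f)
    (hg : Function.Surjective g) (w : ∀ a, g (f a) = 0) (h : ∀ b, g b = 0 → ∃ a, f a = b) :
    IsSES f g := by
  refine ⟨by ext a; exact w a, ?_⟩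
  exact { exact := (ShortComplex.moduleCat_exact_iff _).2 h
          mono_f := (ModuleCat.mono_iff_injective f).2 hf
          epi_g := (ModuleCat.epi_iff_surjective g).2 hg }

variable {f : A ⟶ B} {g : B ⟶ C}

theorem IsSES.injective (h : IsSES f g) : Function.Injective f :=
  h.choose_spec.moduleCat_injective_f

theorem IsSES.surjective (h : IsSES f g) : Function.Surjective g :=
  h.choose_spec.moduleCat_surjective_g

theorem IsSES.apply_apply (h : IsSES f g) (a : A) : g (f a) = 0 :=
  (ShortComplex.mk f g h.choose).moduleCat_zero_apply a

theorem IsSES.exists_of_apply_eq_zero (h : IsSES f g) (b : B) (hb : g b = 0) : ∃ a, f a = b :=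
  (ShortComplex.moduleCat_exact_iff _).1 h.choose_spec.exact b hb

theorem IsSES.extZero_right₁ (h : IsSES f g) {n : ℕ} (h₃ : ExtZero X C (n + 1))
    (h₂ : ExtZero X B (n + 2)) : ExtZero X A (n + 2) := by
  rw [extZero_succ_iff] at *
  obtain ⟨w, h⟩ := h
  intro x
  obtain ⟨y, rfl⟩ := Abelian.Ext.covariant_sequence_exact₁ X h x (h₂ _) rfl
  rw [h₃ y, Abelian.Ext.zero_comp]

theorem IsSES.extZero_right₃ (h : IsSES f g) {n : ℕ} (h₂ : ExtZero X B (n + 1))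
    (h₁ : ExtZero X A (n + 2)) : ExtZero X C (n + 1) := by
  rw [extZero_succ_iff] at *
  obtain ⟨w, h⟩ := h
  intro x
  obtain ⟨y, rfl⟩ := Abelian.Ext.covariant_sequence_exact₃ X h x rfl (h₁ _)
  rw [h₂ y, Abelian.Ext.zero_comp]

theorem IsSES.extZero_left₂ (h : IsSES f g) {n : ℕ} (h₁ : ExtZero A Y (n + 1))
    (h₃ : ExtZero C Y (n + 1)) : ExtZero B Y (n + 1) := by
  rw [extZero_succ_iff] at *
  obtain ⟨w, h⟩ := h
  intro x
  obtain ⟨y, rfl⟩ := Abelian.Ext.contravariant_sequence_exact₂ h Y x (h₁ _)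
  rw [h₃ y, Abelian.Ext.comp_zero]

theorem IsSES.extZero_left₁ (h : IsSES f g) {n : ℕ} (h₂ : ExtZero B Y (n + 1))
    (h₃ : ExtZero C Y (n + 2)) : ExtZero A Y (n + 1) := by
  rw [extZero_succ_iff] at *
  obtain ⟨w, h⟩ := h
  intro x
  obtain ⟨y, rfl⟩ := Abelian.Ext.contravariant_sequence_exact₁ h Y x
    (show 1 + (n + 1) = n + 1 + 1 by omega) (h₃ _)
  rw [h₂ y, Abelian.Ext.comp_zero]

theorem IsSES.exists_lift (h : IsSES f g) (h₁ : ExtZero M A 1) (φ : M ⟶ C) :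
    ∃ ψ : M ⟶ B, ψ ≫ g = φ := by
  rw [extZero_succ_iff] at h₁
  obtain ⟨w, h⟩ := h
  obtain ⟨y, hy⟩ := Abelian.Ext.covariant_sequence_exact₃ M h (Abelian.Ext.mk₀ φ)
    (zero_add 1) (h₁ _)
  obtain ⟨ψ, rfl⟩ := (Abelian.Ext.mk₀_bijective M B).2 y
  rw [Abelian.Ext.mk₀_comp_mk₀] at hy
  exact ⟨ψ, (Abelian.Ext.mk₀_bijective M C).1 hy⟩

theorem IsSES.extZero_one_of_lift (h : IsSES f g) (h₂ : ExtZero M B 1)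
    (hl : ∀ φ : M ⟶ C, ∃ ψ : M ⟶ B, ψ ≫ g = φ) : ExtZero M A 1 := by
  rw [extZero_succ_iff] at *
  obtain ⟨w, h⟩ := h
  intro x
  obtain ⟨y, rfl⟩ := Abelian.Ext.covariant_sequence_exact₁ M h x (h₂ _) (zero_add 1)
  obtain ⟨φ, rfl⟩ := (Abelian.Ext.mk₀_bijective M C).2 y
  obtain ⟨ψ, rfl⟩ := hl φ
  rw [← Abelian.Ext.mk₀_comp_mk₀,
    Abelian.Ext.comp_assoc (h₁₂ := add_zero _) (h₂₃ := zero_add 1) (h := by omega)]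
  exact (congrArg (fun z => (Abelian.Ext.mk₀ ψ).comp z (zero_add 1)) h.comp_extClass).trans
    (Abelian.Ext.comp_zero ..)

theorem IsSES.exists_extension (h : IsSES f g) (h₃ : ExtZero C Y 1) (φ : A ⟶ Y) :
    ∃ ψ : B ⟶ Y, f ≫ ψ = φ := by
  rw [extZero_succ_iff] at h₃
  obtain ⟨w, h⟩ := h
  obtain ⟨y, hy⟩ := Abelian.Ext.contravariant_sequence_exact₁ h Y (Abelian.Ext.mk₀ φ)
    (add_zero 1) (h₃ _)
  obtain ⟨ψ, rfl⟩ := (Abelian.Ext.mk₀_bijective B Y).2 y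
  rw [Abelian.Ext.mk₀_comp_mk₀] at hy
  exact ⟨ψ, (Abelian.Ext.mk₀_bijective A Y).1 hy⟩

theorem extZero_of_retract {s : M ⟶ N} {r : N ⟶ M} (hsr : s ≫ r = 𝟙 M) {n : ℕ}
    (h : ExtZero X N (n + 1)) : ExtZero X M (n + 1) := by
  rw [extZero_succ_iff] at *
  intro x
  rw [← x.comp_mk₀_id, ← hsr, ← Abelian.Ext.mk₀_comp_mk₀,
    ← Abelian.Ext.comp_assoc (h₁₂ := add_zero _) (h₂₃ := zero_add _) (h := by omega),
    h (x.comp _ _), Abelian.Ext.zero_comp]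

theorem extZero_of_injective (M I : ModuleCat.{u} R) [Injective I] (n : ℕ) :
    ExtZero M I (n + 1) :=
  (extZero_succ_iff _ _ _).2 fun x => x.eq_zero_of_injective

theorem extZero_of_projective (P M : ModuleCat.{u} R) [Projective P] (n : ℕ) :
    ExtZero P M (n + 1) :=
  isZero_Ext_succ_of_projective P M n

theorem exists_injective_isSES (M : ModuleCat.{u} R) :
    ∃ (I C : ModuleCat.{u} R) (f : M ⟶ I) (g : I ⟶ C), Injective I ∧ IsSES f g := by
  refine ⟨Injective.under M, cokernel (Injective.ι M), Injective.ι M, cokernel.π _,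
    inferInstance, cokernel.condition _, ?_⟩
  exact { exact := ShortComplex.exact_cokernel _
          mono_f := inferInstanceAs (Mono (Injective.ι M))
          epi_g := inferInstanceAs (Epi (cokernel.π _)) }

theorem exists_free_isSES (M : ModuleCat.{u} R) :
    ∃ (K F : ModuleCat.{u} R) (f : K ⟶ F) (g : F ⟶ M), Module.Free R F ∧ IsSES f g := by
  let p : (M →₀ R) →ₗ[R] M := Finsupp.linearCombination R id
  refine ⟨.of R (LinearMap.ker p), .of R (M →₀ R), ModuleCat.ofHom (LinearMap.ker p).subtype,
    ModuleCat.ofHom p, inferInstanceAs (Module.Free R (M →₀ R)), IsSES.mk' ?_ ?_ ?_ ?_⟩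
  · exact Subtype.val_injective
  · exact Finsupp.linearCombination_id_surjective R M
  · exact fun a => a.2
  · exact fun b hb => ⟨⟨b, hb⟩, rfl⟩

end ExtVanishing

section Constructions

variable {R : Type u} [Ring R] {A B C A' M X Y Z : ModuleCat.{u} R}

theorem isSES_id_left (M : ModuleCat.{u} R) : IsSES (𝟙 M) (0 : M ⟶ ModuleCat.of R PUnit.{u + 1}) :=
  IsSES.mk' Function.injective_id (fun _ => ⟨0, rfl⟩) (fun _ => rfl) fun b _ => ⟨b, rfl⟩

theorem isSES_id_right (M : ModuleCat.{u} R) :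
    IsSES (0 : ModuleCat.of R PUnit.{u + 1} ⟶ M) (𝟙 M) :=
  IsSES.mk' (fun _ _ _ => rfl) Function.surjective_id (fun _ => rfl)
    fun b hb => ⟨0, (show b = 0 from hb) ▸ rfl⟩

/-- The pushout of a short exact sequence along a morphism out of its first term. -/
theorem IsSES.exists_pushout {f : A ⟶ B} {g : B ⟶ C} (h : IsSES f g) (a : A ⟶ A') :
    ∃ (B' : ModuleCat.{u} R) (f' : A' ⟶ B') (g' : B' ⟶ C) (b : B ⟶ B'),
      IsSES f' g' ∧
      (∀ {Q : ModuleCat.{u} R} (q : A' ⟶ Q), IsSES a q → ∃ q' : B' ⟶ Q, IsSES b q') ∧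
      (∀ {K : ModuleCat.{u} R} (k : K ⟶ A), IsSES k a → IsSES (k ≫ f) b) := by
  let N : Submodule R (A' × B) := LinearMap.range (LinearMap.prod a.hom (-f.hom))
  have hN : ∀ p : A' × B, p ∈ N ↔ ∃ x : A, a x = p.1 ∧ -f x = p.2 := fun p =>
    ⟨fun ⟨x, hx⟩ => ⟨x, congrArg Prod.fst hx, congrArg Prod.snd hx⟩,
      fun ⟨x, h₁, h₂⟩ => ⟨x, Prod.ext h₁ h₂⟩⟩
  have hmk : ∀ p : A' × B, N.mkQ p = 0 ↔ ∃ x : A, a x = p.1 ∧ -f x = p.2 := fun p => by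
    rw [← hN, Submodule.mkQ_apply, Submodule.Quotient.mk_eq_zero]
  let f' : A' →ₗ[R] (A' × B) ⧸ N := N.mkQ ∘ₗ LinearMap.inl R A' B
  let b : B →ₗ[R] (A' × B) ⧸ N := N.mkQ ∘ₗ LinearMap.inr R A' B
  let g' : ((A' × B) ⧸ N) →ₗ[R] C := N.liftQ (g.hom ∘ₗ LinearMap.snd R A' B) (by
    rintro p hp
    obtain ⟨x, -, h₂⟩ := (hN p).1 hp
    change g p.2 = 0
    rw [← h₂, map_neg, h.apply_apply, neg_zero])
  refine ⟨.of R ((A' × B) ⧸ N), ModuleCat.ofHom f', ModuleCat.ofHom g', ModuleCat.ofHom b,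
    IsSES.mk' ?_ ?_ ?_ ?_, ?_, ?_⟩
  · refine (injective_iff_map_eq_zero f').2 fun y hy => ?_
    obtain ⟨x, h₁, h₂⟩ := (hmk _).1 hy
    have hx : x = 0 := h.injective (by rw [map_zero]; exact neg_eq_zero.1 h₂)
    subst hx
    exact h₁.symm.trans (map_zero _)
  · intro c
    obtain ⟨x, rfl⟩ := h.surjective c
    exact ⟨N.mkQ (0, x), rfl⟩
  · intro y
    exact map_zero g.hom
  · intro p hp
    obtain ⟨⟨y, z⟩, rfl⟩ := N.mkQ_surjective p
    obtain ⟨x, rfl⟩ := h.exists_of_apply_eq_zero z hp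
    refine ⟨y + a x, ?_⟩
    refine sub_eq_zero.1 ((map_sub N.mkQ (y + a x, (0 : B)) (y, f x)).symm.trans
      ((hmk _).2 ⟨x, ?_, ?_⟩)) <;> simp
  · intro Q q hq
    let q' : ((A' × B) ⧸ N) →ₗ[R] Q := N.liftQ (q.hom ∘ₗ LinearMap.fst R A' B) (by
      rintro p hp
      obtain ⟨x, h₁, -⟩ := (hN p).1 hp
      change q p.1 = 0
      rw [← h₁, hq.apply_apply])
    refine ⟨ModuleCat.ofHom q', IsSES.mk' ?_ ?_ ?_ ?_⟩
    · refine (injective_iff_map_eq_zero b).2 fun y hy => ?_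
      obtain ⟨x, h₁, h₂⟩ := (hmk _).1 hy
      have hx : x = 0 := hq.injective (by rw [map_zero]; exact h₁)
      subst hx
      refine h₂.symm.trans ?_
      rw [map_zero, neg_zero]
    · intro c
      obtain ⟨x, rfl⟩ := hq.surjective c
      exact ⟨N.mkQ (x, 0), rfl⟩
    · intro y
      exact map_zero q.hom
    · intro p hp
      obtain ⟨⟨y, z⟩, rfl⟩ := N.mkQ_surjective p
      obtain ⟨x, rfl⟩ := hq.exists_of_apply_eq_zero y hp
      refine ⟨z + f x, ?_⟩
      refine sub_eq_zero.1 ((map_sub N.mkQ ((0 : A'), z + f x) (a x, z)).symm.trans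
        ((hmk _).2 ⟨-x, ?_, ?_⟩)) <;> simp
  · intro K k hk
    refine IsSES.mk' (h.injective.comp hk.injective) ?_ ?_ ?_
    · intro p
      obtain ⟨⟨y, z⟩, rfl⟩ := N.mkQ_surjective p
      obtain ⟨x, rfl⟩ := hk.surjective y
      refine ⟨z + f x, ?_⟩
      refine sub_eq_zero.1 ((map_sub N.mkQ ((0 : A'), z + f x) (a x, z)).symm.trans
        ((hmk _).2 ⟨-x, ?_, ?_⟩)) <;> simp
    · intro x
      refine (hmk _).2 ⟨-k x, ?_, ?_⟩
      · rw [map_neg, hk.apply_apply, neg_zero]; rfl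
      · rw [map_neg, neg_neg]; rfl
    · intro y hy
      obtain ⟨x, h₁, h₂⟩ := (hmk _).1 hy
      obtain ⟨z, rfl⟩ := hk.exists_of_apply_eq_zero x h₁
      refine ⟨-z, ?_⟩
      rw [map_neg]
      exact h₂

/-- If `0 → X → P → E → 0` splits and `0 → E → Y → C → 0` is exact, then `P` embeds into `X ⊕ Y`
with cokernel `C`. -/
theorem IsSES.exists_prod_of_split {P E : ModuleCat.{u} R} {i : X ⟶ P} {p : P ⟶ E}
    (h : IsSES i p) {ρ : P ⟶ X} (hρ : i ≫ ρ = 𝟙 X) {t : E ⟶ Y} {q : Y ⟶ C} (ht : IsSES t q) :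
    ∃ (f : P ⟶ ModuleCat.of R (X × Y)) (g : ModuleCat.of R (X × Y) ⟶ C), IsSES f g := by
  have hρ' : ∀ x, ρ (i x) = x := fun x => congr($hρ x)
  refine ⟨ModuleCat.ofHom (LinearMap.prod ρ.hom (p ≫ t).hom),
    ModuleCat.ofHom (q.hom ∘ₗ LinearMap.snd R X Y), IsSES.mk' ?_ ?_ ?_ ?_⟩
  · refine (injective_iff_map_eq_zero (LinearMap.prod ρ.hom (p ≫ t).hom)).2 fun y hy => ?_
    have h₁ : ρ y = 0 := congrArg Prod.fst hy
    have h₂ : t (p y) = 0 := congrArg Prod.snd hy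
    obtain ⟨x, rfl⟩ := h.exists_of_apply_eq_zero y (ht.injective (by rw [h₂, map_zero]))
    rw [hρ'] at h₁
    rw [h₁, map_zero]
  · intro c
    obtain ⟨y, rfl⟩ := ht.surjective c
    exact ⟨(0, y), rfl⟩
  · exact fun y => ht.apply_apply (p y)
  · rintro ⟨x, y⟩ hy
    obtain ⟨e, rfl⟩ := ht.exists_of_apply_eq_zero y hy
    obtain ⟨z, rfl⟩ := h.surjective e
    refine ⟨z + i (x - ρ z), Prod.ext ?_ ?_⟩
    · change ρ (z + i (x - ρ z)) = x
      rw [map_add, hρ', add_sub_cancel]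
    · change t (p (z + i (x - ρ z))) = t (p z)
      rw [map_add, h.apply_apply, add_zero]

theorem IsSES.finsupp {f : A ⟶ B} {g : B ⟶ C} (h : IsSES f g) (I : Type u) :
    IsSES (ModuleCat.ofHom (Finsupp.mapRange.linearMap (α := I) f.hom))
      (ModuleCat.ofHom (Finsupp.mapRange.linearMap (α := I) g.hom)) := by
  refine IsSES.mk' ?_ ?_ ?_ ?_
  · exact Finsupp.mapRange_injective _ (map_zero _) h.injective
  · exact Finsupp.mapRange_surjective _ (map_zero _) h.surjective
  · intro x
    ext i
    exact h.apply_apply (x i)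
  · intro y hy
    have hy' : ∀ i, g (y i) = 0 := fun i => DFunLike.congr_fun hy i
    choose s hs using fun i => h.exists_of_apply_eq_zero (y i) (hy' i)
    refine ⟨Finsupp.onFinset y.support s fun i hi => ?_, Finsupp.ext hs⟩
    rw [Finsupp.mem_support_iff, ← hs i]
    exact fun h0 => hi (h.injective (by rw [h0, map_zero]))

/-- The Eilenberg swindle: a direct summand of a free module has a free resolution of length `1`. -/
theorem exists_free_isSES_of_retract {F : ModuleCat.{u} R} [Module.Free R F] {s : M ⟶ F}
    {r : F ⟶ M} (hsr : s ≫ r = 𝟙 M) :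
    ∃ (F₁ F₀ : ModuleCat.{u} R) (f : F₁ ⟶ F₀) (g : F₀ ⟶ M),
      Module.Free R F₁ ∧ Module.Free R F₀ ∧ IsSES f g := by
  have hs : Function.LeftInverse r s := fun x => congr($hsr x)
  let N := LinearMap.ker r.hom
  let e₀ : F ≃ₗ[R] M × N := LinearEquiv.ofBijective
    (LinearMap.prod r.hom (LinearMap.codRestrict N (LinearMap.id - s.hom ∘ₗ r.hom) fun x => by
      change r (x - s (r x)) = 0
      rw [map_sub, hs, sub_self])) (by
    constructor
    · refine (injective_iff_map_eq_zero _).2 fun x hx => ?_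
      have h₁ : r x = 0 := congrArg Prod.fst hx
      have h₂ : x - s (r x) = 0 := congrArg (Subtype.val ∘ Prod.snd) hx
      rwa [h₁, map_zero, sub_zero] at h₂
    · rintro ⟨x, y, hy⟩
      have hy : r y = 0 := hy
      have h₁ : r (s x + y) = x := by rw [map_add, hs, hy, add_zero]
      refine ⟨s x + y, Prod.ext h₁ (Subtype.ext ?_)⟩
      change s x + y - s (r (s x + y)) = y
      rw [h₁, add_sub_cancel_left])
  let f₁ : (ℕ →₀ M × N) →ₗ[R] (ℕ →₀ M) × (ℕ →₀ N) :=
    LinearMap.prod (Finsupp.mapRange.linearMap (LinearMap.fst R M N))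
      (Finsupp.mapRange.linearMap (LinearMap.snd R M N))
  let f₂ : (ℕ →₀ M) × (ℕ →₀ N) →ₗ[R] (ℕ →₀ M × N) :=
    LinearMap.coprod (Finsupp.mapRange.linearMap (LinearMap.inl R M N))
      (Finsupp.mapRange.linearMap (LinearMap.inr R M N))
  have h₁₂ : f₁ ∘ₗ f₂ = LinearMap.id := by ext <;> simp [f₁, f₂]
  have h₂₁ : f₂ ∘ₗ f₁ = LinearMap.id := by ext <;> simp [f₁, f₂]
  let e₁' : (ℕ →₀ M × N) ≃ₗ[R] (ℕ →₀ M) × (ℕ →₀ N) := LinearEquiv.ofLinearMap f₁ f₂ h₁₂ h₂₁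
  let e₁ : (ℕ →₀ F) ≃ₗ[R] (ℕ →₀ M) × (ℕ →₀ N) := (Finsupp.mapRange.linearEquiv e₀).trans e₁'
  let e₂ : (ℕ →₀ M) ≃ₗ[R] M × (ℕ →₀ M) :=
    (Finsupp.domLCongr (Equiv.natSumPUnitEquivNat.{0}.symm.trans (Equiv.sumComm ℕ PUnit))).trans
      ((Finsupp.sumFinsuppLEquivProdFinsupp R).trans
        ((Finsupp.uniqueLinearEquiv R M PUnit.unit).prodCongr (LinearEquiv.refl R _)))
  let e : (ℕ →₀ F) ≃ₗ[R] M × (ℕ →₀ F) :=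
    e₁.trans ((e₂.prodCongr (LinearEquiv.refl R _)).trans
      ((LinearEquiv.prodAssoc R _ _ _).trans ((LinearEquiv.refl R M).prodCongr e₁.symm)))
  refine ⟨.of R (ℕ →₀ F), .of R (M × (ℕ →₀ F)), ModuleCat.ofHom (LinearMap.inr R M _),
    ModuleCat.ofHom (LinearMap.fst R M _), inferInstanceAs (Module.Free R (ℕ →₀ F)),
    Module.Free.of_equiv e, IsSES.mk' ?_ ?_ ?_ ?_⟩
  · exact LinearMap.inr_injective
  · exact LinearMap.fst_surjective
  · exact fun _ => rfl
  · exact fun y hy => ⟨y.2, Prod.ext (Eq.symm hy) rfl⟩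

end Constructions

section Tilting

variable {R : Type u} [Ring R] {T : ModuleCat.{u} R} {A B C M N X Y : ModuleCat.{u} R}

theorem addT_of_retract {s : M ⟶ N} {r : N ⟶ M} (hsr : s ≫ r = 𝟙 M) (hN : N ∈ AddT T) :
    M ∈ AddT T := by
  obtain ⟨I, s', r', h⟩ := hN
  exact ⟨I, s ≫ s', r' ≫ r, by rw [Category.assoc, reassoc_of% h, hsr]⟩

theorem addT_punit : ModuleCat.of R PUnit.{u + 1} ∈ AddT T :=
  ⟨PUnit, 0, 0, by ext⟩

theorem addT_of_equiv {I : Type u} (e : M ≃ₗ[R] (I →₀ T)) : M ∈ AddT T :=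
  ⟨I, e.toModuleIso.hom, e.toModuleIso.inv, e.toModuleIso.hom_inv_id⟩

theorem addT_finsupp (hM : M ∈ AddT T) (I : Type u) : ModuleCat.of R (I →₀ M) ∈ AddT T := by
  obtain ⟨J, s, r, h⟩ := hM
  have h' : ∀ x, r (s x) = x := fun x => congr($h x)
  refine addT_of_retract (N := ModuleCat.of R (I →₀ J →₀ T))
    (s := ModuleCat.ofHom (Finsupp.mapRange.linearMap s.hom))
    (r := ModuleCat.ofHom (Finsupp.mapRange.linearMap r.hom)) ?_
    (addT_of_equiv (Finsupp.curryLinearEquiv R).symm)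
  refine ModuleCat.hom_ext (LinearMap.ext fun x => Finsupp.ext fun i => ?_)
  exact h' (x i)

theorem addT_prod (hM : M ∈ AddT T) (hN : N ∈ AddT T) : ModuleCat.of R (M × N) ∈ AddT T := by
  obtain ⟨I, s, r, h⟩ := hM
  obtain ⟨J, s', r', h'⟩ := hN
  refine addT_of_retract (N := ModuleCat.of R ((I →₀ T) × (J →₀ T)))
    (s := ModuleCat.ofHom (LinearMap.prodMap s.hom s'.hom))
    (r := ModuleCat.ofHom (LinearMap.prodMap r.hom r'.hom)) ?_
    (addT_of_equiv (Finsupp.sumFinsuppLEquivProdFinsupp R).symm)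
  refine ModuleCat.hom_ext (LinearMap.ext fun x => Prod.ext ?_ ?_)
  · exact congr($h x.1)
  · exact congr($h' x.2)

theorem HasCoresLen.succ {n : ℕ} (h : HasCoresLen (AddT T) n M) :
    HasCoresLen (AddT T) (n + 1) M := by
  induction n generalizing M with
  | zero => exact ⟨_, _, _, _, h, isSES_id_left M, addT_punit⟩
  | succ n ih =>
    obtain ⟨X, C, f, g, hX, hfg, hC⟩ := h
    exact ⟨X, C, f, g, hX, hfg, ih hC⟩

theorem HasCoresLen.mono_right {n m : ℕ} (h : HasCoresLen (AddT T) n M) (hnm : n ≤ m) :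
    HasCoresLen (AddT T) m M := by
  induction hnm with
  | refl => exact h
  | step _ ih => exact ih.succ

theorem HasCoresLen.mono_left {𝒳 𝒴 : Set (ModuleCat.{u} R)} (hs : 𝒳 ⊆ 𝒴) {n : ℕ}
    (h : HasCoresLen 𝒳 n M) : HasCoresLen 𝒴 n M := by
  induction n generalizing M with
  | zero => exact hs h
  | succ n ih =>
    obtain ⟨X, C, f, g, hX, hfg, hC⟩ := h
    exact ⟨X, C, f, g, hs hX, hfg, ih hC⟩

theorem HasCoresLen.finsupp {n : ℕ} (h : HasCoresLen (AddT T) n M) (I : Type u) :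
    HasCoresLen (AddT T) n (ModuleCat.of R (I →₀ M)) := by
  induction n generalizing M with
  | zero => exact addT_finsupp h I
  | succ n ih =>
    obtain ⟨X, C, f, g, hX, hfg, hC⟩ := h
    exact ⟨_, _, _, _, addT_finsupp hX I, hfg.finsupp I, ih hC⟩

theorem HasCoresLen.of_equiv {n : ℕ} (h : HasCoresLen (AddT T) n M) (e : N ≃ₗ[R] M) :
    HasCoresLen (AddT T) n N := by
  cases n with
  | zero => exact addT_of_retract e.toModuleIso.hom_inv_id h
  | succ n =>
    obtain ⟨X, C, f, g, hX, hfg, hC⟩ := h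
    refine ⟨X, C, ModuleCat.ofHom (f.hom ∘ₗ e.toLinearMap), g, hX, IsSES.mk' ?_ hfg.surjective
      (fun a => hfg.apply_apply _) fun b hb => ?_, hC⟩
    · exact hfg.injective.comp e.injective
    · obtain ⟨a, rfl⟩ := hfg.exists_of_apply_eq_zero b hb
      exact ⟨e.symm a, congrArg f (e.apply_symm_apply a)⟩

theorem exists_hasCoresLen_of_free {n : ℕ} (h : HasCoresLen (AddT T) n (ModuleCat.of R R))
    (F : ModuleCat.{u} R) [Module.Free R F] : HasCoresLen (AddT T) n F :=
  (h.finsupp (Module.Free.ChooseBasisIndex R F)).of_equiv (Module.Free.chooseBasis R F).repr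

theorem rperpAll_iff : M ∈ rperpAll T ↔ ∀ n, ExtZero T M (n + 1) :=
  ⟨fun h n => h (n + 1) n.succ_pos, fun h i hi => by
    obtain ⟨n, rfl⟩ := Nat.exists_eq_succ_of_ne_zero hi.ne'
    exact h n⟩

/-- The right-hand class of the pair induced by `T` is closed under cokernels of monomorphisms. -/
theorem IsSES.mem_rperpAll {f : A ⟶ B} {g : B ⟶ C} (h : IsSES f g) (hA : A ∈ rperpAll T)
    (hB : B ∈ rperpAll T) : C ∈ rperpAll T := by
  rw [rperpAll_iff] at *
  exact fun n => h.extZero_right₃ (hB n) (hA (n + 1))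

theorem mem_rperpAll_of_injective (I : ModuleCat.{u} R) [Injective I] : I ∈ rperpAll T :=
  rperpAll_iff.2 fun n => extZero_of_injective T I n

/-- The cotorsion pair induced by `T` is hereditary. -/
theorem extZero_of_mem_lperp1 (hA : A ∈ lperp1 (rperpAll T)) (hB : B ∈ rperpAll T) (n : ℕ) :
    ExtZero A B (n + 1) := by
  induction n generalizing B with
  | zero => exact hA B hB
  | succ n ih =>
    obtain ⟨I, C, f, g, hI, h⟩ := exists_injective_isSES B
    exact h.extZero_right₁ (ih (h.mem_rperpAll hB (mem_rperpAll_of_injective I)))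
      (extZero_of_injective A I (n + 1))

theorem self_mem_lperp1 : T ∈ lperp1 (rperpAll T) := fun _ hB => hB 1 one_pos

theorem mem_lperp1_of_projective [Projective M] : M ∈ lperp1 (rperpAll T) :=
  fun B _ => extZero_of_projective M B 0

theorem addT_subset_lperp1 : AddT T ⊆ lperp1 (rperpAll T) := by
  rintro M ⟨J, s, r, hsr⟩ B hB
  obtain ⟨I, C, f, g, hI, h⟩ := exists_injective_isSES B
  refine h.extZero_one_of_lift (extZero_of_injective M I 0) fun φ => ?_
  choose ψ hψ using fun j : J =>
    h.exists_lift (hB 1 one_pos) (ModuleCat.ofHom (Finsupp.lsingle j) ≫ r ≫ φ)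
  let Ψ : (J →₀ T) →ₗ[R] I := Finsupp.lsum ℕ fun j => (ψ j).hom
  have hΨ : ModuleCat.ofHom Ψ ≫ g = r ≫ φ := by
    refine ModuleCat.hom_ext (Finsupp.lhom_ext fun j t => ?_)
    change g (Ψ (Finsupp.single j t)) = φ (r (Finsupp.single j t))
    rw [Finsupp.lsum_single]
    exact congr($(hψ j) t)
  exact ⟨s ≫ ModuleCat.ofHom Ψ, by rw [Category.assoc, hΨ, reassoc_of% hsr]⟩

theorem IsTilting.addT_subset_rperpAll (hT : IsTilting T) : AddT T ⊆ rperpAll T := by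
  rintro M ⟨J, s, r, hsr⟩
  exact rperpAll_iff.2 fun n => extZero_of_retract hsr (hT.2.1 (n + 1) n.succ_pos J)

theorem HasCoresLen.mem_lperp1 {n : ℕ} (h : HasCoresLen (AddT T) n M) :
    M ∈ lperp1 (rperpAll T) := by
  induction n generalizing M with
  | zero => exact addT_subset_lperp1 h
  | succ n ih =>
    obtain ⟨X, C, f, g, hX, hfg, hC⟩ := h
    exact fun B hB => hfg.extZero_left₁ (addT_subset_lperp1 hX B hB)
      (extZero_of_mem_lperp1 (ih hC) hB 1)

theorem IsSES.mem_lperp1 {f : A ⟶ B} {g : B ⟶ C} (h : IsSES f g)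
    (hA : A ∈ lperp1 (rperpAll T)) (hC : C ∈ lperp1 (rperpAll T)) : B ∈ lperp1 (rperpAll T) :=
  fun Y hY => h.extZero_left₂ (hA Y hY) (hC Y hY)

theorem projective_of_free (F : ModuleCat.{u} R) [Module.Free R F] : Projective F :=
  (IsProjective.iff_projective (R := R) (P := F)).1 Module.Projective.of_free

/-- Modules with a finite `Add T`-coresolution are closed under extensions. -/
theorem IsTilting.hasCoresLen_of_isSES (hT : IsTilting T) {n : ℕ} {f : A ⟶ B} {g : B ⟶ C}
    (h : IsSES f g) (hA : HasCoresLen (AddT T) n A) (hC : HasCoresLen (AddT T) n C) :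
    HasCoresLen (AddT T) n B := by
  induction n generalizing A B C with
  | zero =>
    obtain ⟨ρ, hρ⟩ := h.exists_extension
      (addT_subset_lperp1 hC A (hT.addT_subset_rperpAll hA)) (𝟙 A)
    obtain ⟨i, q, hiq⟩ := h.exists_prod_of_split hρ (isSES_id_left C)
    have := projective_of_free (ModuleCat.of R PUnit.{u + 1})
    obtain ⟨r, hr⟩ := hiq.exists_extension (extZero_of_projective _ B 0) (𝟙 B)
    exact addT_of_retract hr (addT_prod hA hC)
  | succ n ih =>
    obtain ⟨T₁, C₁, t₁, q₁, hT₁, h₁, hC₁⟩ := hA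
    obtain ⟨T₂, C₂, t₂, q₂, hT₂, h₂, hC₂⟩ := id hC
    obtain ⟨P, i, p, b, hip, hb, -⟩ := h.exists_pushout t₁
    obtain ⟨q, hbq⟩ := hb q₁ h₁
    obtain ⟨ρ, hρ⟩ := hip.exists_extension
      (hC.mem_lperp1 T₁ (hT.addT_subset_rperpAll hT₁)) (𝟙 T₁)
    obtain ⟨j, k, hjk⟩ := hip.exists_prod_of_split hρ h₂
    obtain ⟨D, f', g', d, hfg, -, hd⟩ := hjk.exists_pushout q
    exact ⟨_, D, _, _, addT_prod hT₁ hT₂, hd b hbq, ih hfg hC₁ hC₂⟩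

/-- Modules with a finite free resolution have a special `T^⊥`-preenvelope which is moreover a
quotient of a module in `Add T` by a module in `T^⊥`. -/
theorem IsTilting.exists_preenvelope (hT : IsTilting T) {n : ℕ}
    (hM : HasResLen {F | Module.Free R F} n M) :
    ∃ (Y X : ModuleCat.{u} R) (f : M ⟶ Y) (g : Y ⟶ X), IsSES f g ∧
      (∃ k, HasCoresLen (AddT T) k X) ∧
      ∃ (Y' T₀ : ModuleCat.{u} R) (i : Y' ⟶ T₀) (p : T₀ ⟶ Y), IsSES i p ∧
        Y' ∈ rperpAll T ∧ T₀ ∈ AddT T := by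
  obtain ⟨m, hm⟩ := hT.2.2
  induction n generalizing M with
  | zero =>
    have : Module.Free R M := hM
    obtain ⟨T₀, X, f, g, hT₀, hfg, hX⟩ := (exists_hasCoresLen_of_free hm M).succ
    exact ⟨T₀, X, f, g, hfg, ⟨_, hX⟩, _, T₀, _, _, isSES_id_right T₀,
      hT.addT_subset_rperpAll addT_punit, hT₀⟩
  | succ n ih =>
    obtain ⟨K, F, f, g, hF, hfg, hK⟩ := hM
    obtain ⟨Y, X, t, q, htq, ⟨k, hX⟩, Y', T₀, i, p, hip, hY', hT₀⟩ := ih hK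
    have : Module.Free R F := hF
    obtain ⟨E, f', g', b, hfg', hE, -⟩ := hfg.exists_pushout t
    obtain ⟨q', hq'⟩ := hE q htq
    have hE' : HasCoresLen (AddT T) (max m k) E := hT.hasCoresLen_of_isSES hq'
      ((exists_hasCoresLen_of_free hm F).mono_right (le_max_left _ _))
      (hX.mono_right (le_max_right _ _))
    obtain ⟨T₁, X₁, t₁, q₁, hT₁, h₁, hX₁⟩ := hE'.succ
    obtain ⟨Z, f'', g'', z, hZ, -, hz⟩ := h₁.exists_pushout g'
    exact ⟨Z, X₁, f'', g'', hZ, ⟨_, hX₁⟩, Y, T₁, _, z, hz f' hfg',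
      hip.mem_rperpAll hY' (hT.addT_subset_rperpAll hT₀), hT₁⟩

theorem hasResLen_free_succ {n : ℕ}
    (h : ∀ j, n ≤ j → ∀ N : ModuleCat.{u} R, ExtZero M N (j + 1)) :
    HasResLen {F : ModuleCat.{u} R | Module.Free R F} (n + 1) M := by
  induction n generalizing M with
  | zero =>
    obtain ⟨K, F, f, g, hF, hfg⟩ := exists_free_isSES M
    obtain ⟨s, hs⟩ := hfg.exists_lift (h 0 le_rfl K) (𝟙 M)
    obtain ⟨F₁, F₀, i, p, hF₁, hF₀, hip⟩ := exists_free_isSES_of_retract hs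
    exact ⟨F₁, F₀, i, p, hF₀, hip, hF₁⟩
  | succ n ih =>
    obtain ⟨K, F, f, g, hF, hfg⟩ := exists_free_isSES M
    have := projective_of_free F
    exact ⟨K, F, f, g, hF, hfg, ih fun j hj N =>
      hfg.extZero_left₁ (extZero_of_projective F N j) (h (j + 1) (by omega) N)⟩

theorem extZero_of_hasCoresLen {𝒳 : Set (ModuleCat.{u} R)}
    (hX : ∀ X ∈ 𝒳, ∀ n, ExtZero A X (n + 1)) {n : ℕ} (hM : HasCoresLen 𝒳 n M) {j : ℕ}
    (hj : n ≤ j) : ExtZero A M (j + 1) := by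
  induction n generalizing M j with
  | zero => exact hX M hM j
  | succ n ih =>
    obtain ⟨X, C, f, g, hX', hfg, hC⟩ := hM
    obtain ⟨j, rfl⟩ : ∃ i, j = i + 1 := ⟨j - 1, by omega⟩
    exact hfg.extZero_right₁ (ih hC (by omega)) (hX X hX' (j + 1))

theorem hasCoresLen_rperpAll {n : ℕ} (h : ∀ j, n ≤ j → ExtZero T M (j + 1)) :
    HasCoresLen (rperpAll T) n M := by
  induction n generalizing M with
  | zero => exact rperpAll_iff.2 fun j => h j j.zero_le
  | succ n ih =>
    obtain ⟨I, C, f, g, hI, hfg⟩ := exists_injective_isSES M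
    exact ⟨I, C, f, g, mem_rperpAll_of_injective I, hfg, ih fun j hj =>
      hfg.extZero_right₃ (extZero_of_injective T I j) (h (j + 1) (by omega))⟩

/-- A module of finite projective dimension in `^⊥(T^⊥)` embeds into a module in `Add T` with
cokernel in `^⊥(T^⊥)`. -/
theorem IsTilting.exists_addT_isSES (hT : IsTilting T) (hM : M ∈ lperp1 (rperpAll T)) {n : ℕ}
    (h : ∀ j, n ≤ j → ∀ N : ModuleCat.{u} R, ExtZero M N (j + 1)) :
    ∃ (Y X : ModuleCat.{u} R) (f : M ⟶ Y) (g : Y ⟶ X), IsSES f g ∧ Y ∈ AddT T ∧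
      X ∈ lperp1 (rperpAll T) := by
  obtain ⟨Y, X, f, g, hfg, ⟨k, hX⟩, Y', T₀, i, p, hip, hY', hT₀⟩ :=
    hT.exists_preenvelope (hasResLen_free_succ h)
  obtain ⟨s, hs⟩ := hip.exists_lift (hfg.mem_lperp1 hM hX.mem_lperp1 Y' hY') (𝟙 Y)
  exact ⟨Y, X, f, g, hfg, addT_of_retract hs hT₀, hX.mem_lperp1⟩

theorem IsTilting.hasCoresLen_addT (hT : IsTilting T) {m : ℕ}
    (hm : ∀ A ∈ lperp1 (rperpAll T), ∀ j, m ≤ j → ∀ N : ModuleCat.{u} R, ExtZero A N (j + 1))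
    (hM : M ∈ lperp1 (rperpAll T)) {n : ℕ} (h : ∀ j, n ≤ j → ExtZero T M (j + 1)) :
    HasCoresLen (AddT T) n M := by
  induction n generalizing M with
  | zero =>
    obtain ⟨Y, X, f, g, hfg, hY, hX⟩ := hT.exists_addT_isSES hM (hm M hM)
    obtain ⟨r, hr⟩ := hfg.exists_extension
      (hX M (rperpAll_iff.2 fun j => h j j.zero_le)) (𝟙 M)
    exact addT_of_retract hr hY
  | succ n ih =>
    obtain ⟨Y, X, f, g, hfg, hY, hX⟩ := hT.exists_addT_isSES hM (hm M hM)
    exact ⟨Y, X, f, g, hY, hfg, ih hX fun j hj => hfg.extZero_right₃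
      (rperpAll_iff.1 (hT.addT_subset_rperpAll hY) j) (h (j + 1) (by omega))⟩

end Tilting

section Dimensions

variable {R : Type u} [Ring R] {T M : ModuleCat.{u} R} {𝒳 𝒴 : Set (ModuleCat.{u} R)}

theorem rpd_le_iff {n : ℕ} :
    rpd 𝒳 M ≤ n ↔ ∀ j, n ≤ j → ∀ X ∈ 𝒳, ExtZero M X (j + 1) := by
  constructor
  · intro h j hj X hX
    have hmem := csInf_mem (s := {n : ℕ∞ | ∀ j : ℕ, n < (j : ℕ∞) → ∀ X ∈ 𝒳, ExtZero M X j})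
      ⟨⊤, fun j hj => absurd hj not_top_lt⟩
    exact hmem (j + 1) (lt_of_le_of_lt h (by exact_mod_cast Nat.lt_succ_of_le hj)) X hX
  · intro h
    refine sInf_le fun j hj X hX => ?_
    have hj : n < j := by exact_mod_cast hj
    obtain ⟨j, rfl⟩ : ∃ i, j = i + 1 := ⟨j - 1, by omega⟩
    exact h j (by omega) X hX

theorem rpdClass_le_iff {n : ℕ} :
    rpdClass 𝒳 𝒴 ≤ n ↔ ∀ M ∈ 𝒴, ∀ j, n ≤ j → ∀ X ∈ 𝒳, ExtZero M X (j + 1) := by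
  simp only [rpdClass, iSup_le_iff, Subtype.forall, rpd_le_iff]

theorem coresdim_le_iff {n : ℕ} : coresdim 𝒳 M ≤ n ↔ ∃ m ≤ n, HasCoresLen 𝒳 m M := by
  constructor
  · intro h
    by_cases hne : Nonempty {n : ℕ // HasCoresLen 𝒳 n M}
    · obtain ⟨⟨m, hm⟩, h'⟩ := ciInf_mem fun n : {n : ℕ // HasCoresLen 𝒳 n M} => ((n : ℕ) : ℕ∞)
      refine ⟨m, ?_, hm⟩
      have : (m : ℕ∞) ≤ n := h'.trans_le h
      exact_mod_cast this
    · rw [not_nonempty_iff] at hne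
      rw [coresdim, iInf_of_empty, top_le_iff] at h
      exact absurd h (ENat.natCast_ne_top n)
  · rintro ⟨m, hmn, hm⟩
    exact (iInf_le _ ⟨m, hm⟩).trans (by exact_mod_cast hmn)

theorem coresdimClass_le_iff {n : ℕ} :
    coresdimClass 𝒳 𝒴 ≤ n ↔ ∀ M ∈ 𝒴, ∃ m ≤ n, HasCoresLen 𝒳 m M := by
  simp only [coresdimClass, iSup_le_iff, Subtype.forall, coresdim_le_iff]

/-- If the projective dimension of `T` is finite, it is detected by free modules. -/
theorem pd_le_of_free (hT : pd T < ⊤) {n : ℕ}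
    (h : ∀ j, n ≤ j → ∀ F : ModuleCat.{u} R, Module.Free R F → ExtZero T F (j + 1)) :
    pd T ≤ n := by
  obtain ⟨m, hm⟩ := ENat.ne_top_iff_exists.1 hT.ne
  have hm' := rpd_le_iff.1 hm.ge
  have key : ∀ k j, n ≤ j → m ≤ j + k → ∀ X : ModuleCat.{u} R, ExtZero T X (j + 1) := by
    intro k
    induction k with
    | zero => exact fun j _ hj X => hm' j hj X trivial
    | succ k ih =>
      intro j hnj hj X
      obtain ⟨K, F, f, g, hF, hfg⟩ := exists_free_isSES X
      exact hfg.extZero_right₃ (h j hnj F hF) (ih (j + 1) (by omega) (by omega) K)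
  exact rpd_le_iff.2 fun j hj X _ => key m j hj (by omega) X

theorem eq_of_forall_le_natCast_iff {a b : ℕ∞} (h : ∀ n : ℕ, a ≤ n ↔ b ≤ n) : a = b :=
  le_antisymm
    (by cases b with | top => exact le_top | coe n => exact (h n).2 le_rfl)
    (by cases a with | top => exact le_top | coe n => exact (h n).1 le_rfl)

theorem extZero_of_pd_le {n : ℕ} (h : pd T ≤ n) (hM : M ∈ lperp1 (rperpAll T)) {j : ℕ}
    (hj : n ≤ j) (N : ModuleCat.{u} R) : ExtZero M N (j + 1) :=
  extZero_of_hasCoresLen (fun _ hX => extZero_of_mem_lperp1 hM hX)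
    (hasCoresLen_rperpAll fun i hi => rpd_le_iff.1 h i hi N trivial) hj

theorem IsTilting.tfae_dim_le (hT : IsTilting T) (n : ℕ) :
    [pd T ≤ n,
      rpdClass (lperp1 (rperpAll T)) (lperp1 (rperpAll T)) ≤ n,
      coresdimClass (rperpAll T) (lperp1 (rperpAll T)) ≤ n,
      coresdimClass (AddT T) (lperp1 (rperpAll T)) ≤ n,
      coresdimClass (rperpAll T) Set.univ ≤ n].TFAE := by
  simp only [rpdClass_le_iff, coresdimClass_le_iff]
  tfae_have 1 → 2 := fun h M hM j hj N _ => extZero_of_pd_le h hM hj N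
  tfae_have 2 → 1 := fun h => pd_le_of_free hT.1 fun j hj F _ =>
    h T self_mem_lperp1 j hj F (have := projective_of_free F; mem_lperp1_of_projective)
  tfae_have 1 → 4 := fun h M hM => ⟨n, le_rfl, hT.hasCoresLen_addT
    (fun A hA j hj N => extZero_of_pd_le h hA hj N) hM
    fun j hj => rpd_le_iff.1 h j hj M trivial⟩
  tfae_have 4 → 3 := fun h M hM =>
    let ⟨m, hm, hM'⟩ := h M hM
    ⟨m, hm, hM'.mono_left hT.addT_subset_rperpAll⟩
  tfae_have 3 → 1 := fun h => pd_le_of_free hT.1 fun j hj F _ => by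
    have := projective_of_free F
    obtain ⟨m, hm, hF⟩ := h F mem_lperp1_of_projective
    exact extZero_of_hasCoresLen (fun _ hX => rperpAll_iff.1 hX) hF (hm.trans hj)
  tfae_have 1 → 5 := fun h M _ =>
    ⟨n, le_rfl, hasCoresLen_rperpAll fun j hj => rpd_le_iff.1 h j hj M trivial⟩
  tfae_have 5 → 3 := fun h M _ => h M trivial
  tfae_finish

end Dimensions

/-- Theorem 3.2(b): for the tilting cotorsion pair induced by a tilting module `T`,
`pd T = pd_𝒜(𝒜) = coresdim_ℬ(𝒜) = coresdim_{Add T}(𝒜) = coresdim_ℬ(Mod R)`. -/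
theorem stmt10 {R : Type u} [Ring R] (T : ModuleCat.{u} R) (hT : IsTilting T)
    (𝒜 ℬ : Set (ModuleCat.{u} R)) (hB : ℬ = rperpAll T) (hA : 𝒜 = lperp1 ℬ) :
    pd T = rpdClass 𝒜 𝒜 ∧
    rpdClass 𝒜 𝒜 = coresdimClass ℬ 𝒜 ∧
    coresdimClass ℬ 𝒜 = coresdimClass (AddT T) 𝒜 ∧
    coresdimClass (AddT T) 𝒜 = coresdimClass ℬ Set.univ := by
  subst hA hB
  refine ⟨?_, ?_, ?_, ?_⟩ <;> refine eq_of_forall_le_natCast_iff fun n => ?_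
  · exact (hT.tfae_dim_le n).out 0 1
  · exact (hT.tfae_dim_le n).out 1 2
  · exact (hT.tfae_dim_le n).out 2 3
  · exact (hT.tfae_dim_le n).out 3 4

end CotorsionDim
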